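/- Two-particle Caduceus identity in regime 2(a), boundary (1,0,1,0) (from the proof of Lemma 3.2): In ℚ(q, x₁, x₂), writing x̄ᵢ = xᵢ⁻¹, one has b₁(x₁,x̄₂)·b₂(x̄₁,x₂) + c₂(x₁,x₂)·c₁(x₁,x̄₂)·c₁(x̄₁,x₂)·c₂(x̄₁,x̄₂) − x₁²·c₂(x₁,x₂)·c₁(x̄₁,x₂)·b₁(x̄₁,x̄₂) − x₂²·b₁(x₁,x₂)·c₁(x̄₁,x₂)·c₂(x̄₁,x̄₂) + x₁²x₂²·b₁(x₁,x₂)·c₂(x₁,x̄₂)·c₁(x̄₁,x₂)·b₁(x̄₁,x̄₂) = 1. -/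

import Mathlib

noncomputable section

/-- `ℚ(q, x₁, x₂)`, the field of rational functions in `q, x₁, x₂` over `ℚ`. -/
abbrev KQ : Type := FractionRing (MvPolynomial (Fin 3) ℚ)

/-- The element `q` of `ℚ(q, x₁, x₂)`. -/
def qq : KQ := algebraMap (MvPolynomial (Fin 3) ℚ) KQ (MvPolynomial.X 0)

/-- The element `x₁`. -/
def X1 : KQ := algebraMap (MvPolynomial (Fin 3) ℚ) KQ (MvPolynomial.X 1)

/-- The element `x₂`. -/
def X2 : KQ := algebraMap (MvPolynomial (Fin 3) ℚ) KQ (MvPolynomial.X 2)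

/-- R-matrix weight `b₁(u,v) = (u−v)/(u−qv)`. -/
def b1 (u v : KQ) : KQ := (u - v) / (u - qq * v)

/-- R-matrix weight `b₂(u,v) = q(u−v)/(u−qv)`. -/
def b2 (u v : KQ) : KQ := qq * (u - v) / (u - qq * v)

/-- R-matrix weight `c₁(u,v) = (1−q)u/(u−qv)`. -/
def c1 (u v : KQ) : KQ := (1 - qq) * u / (u - qq * v)

/-- R-matrix weight `c₂(u,v) = (1−q)v/(u−qv)`. -/
def c2 (u v : KQ) : KQ := (1 - qq) * v / (u - qq * v)

/-- A polynomial with a nonzero value has nonzero image in the fraction field. -/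
theorem algebraMap_ne_zero_of_eval (p : MvPolynomial (Fin 3) ℚ)
    (h : MvPolynomial.eval ![3, 5, 7] p ≠ 0) :
    algebraMap (MvPolynomial (Fin 3) ℚ) KQ p ≠ 0 := by
  intro h0
  apply h
  have : p = 0 := (IsFractionRing.injective (MvPolynomial (Fin 3) ℚ) KQ) (by rw [h0, map_zero])
  rw [this, map_zero]

/-- The identity in an arbitrary field, away from the poles. -/
theorem caduceus_field {F : Type*} [Field F] (q x y : F) (hx : x ≠ 0) (hy : y ≠ 0)
    (h1 : x - q * y ≠ 0) (h2 : x * y - q ≠ 0) (h3 : 1 - q * x * y ≠ 0) (h4 : y - q * x ≠ 0) :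
    (x - y⁻¹) / (x - q * y⁻¹) * (q * (x⁻¹ - y) / (x⁻¹ - q * y))
      + (1 - q) * y / (x - q * y) * ((1 - q) * x / (x - q * y⁻¹))
        * ((1 - q) * x⁻¹ / (x⁻¹ - q * y)) * ((1 - q) * y⁻¹ / (x⁻¹ - q * y⁻¹))
      - x ^ 2 * ((1 - q) * y / (x - q * y) * ((1 - q) * x⁻¹ / (x⁻¹ - q * y))
        * ((x⁻¹ - y⁻¹) / (x⁻¹ - q * y⁻¹)))
      - y ^ 2 * ((x - y) / (x - q * y) * ((1 - q) * x⁻¹ / (x⁻¹ - q * y))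
        * ((1 - q) * y⁻¹ / (x⁻¹ - q * y⁻¹)))
      + x ^ 2 * y ^ 2 * ((x - y) / (x - q * y) * ((1 - q) * y⁻¹ / (x - q * y⁻¹))
        * ((1 - q) * x⁻¹ / (x⁻¹ - q * y)) * ((x⁻¹ - y⁻¹) / (x⁻¹ - q * y⁻¹))) = 1 := by
  have e2 : x - q * y⁻¹ = (x * y - q) / y := by field_simp
  have e3 : x⁻¹ - q * y = (1 - q * x * y) / x := by field_simp
  have e4 : x⁻¹ - q * y⁻¹ = (y - q * x) / (x * y) := by field_simp
  have n2 : x - y⁻¹ = (x * y - 1) / y := by field_simp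
  have n3 : x⁻¹ - y = (1 - x * y) / x := by field_simp
  have n4 : x⁻¹ - y⁻¹ = (y - x) / (x * y) := by field_simp
  have h3a : 1 - x * y * q ≠ 0 := by convert h3 using 2; ring
  have h1a : x - y * q ≠ 0 := by convert h1 using 2; ring
  have h4a : y - x * q ≠ 0 := by convert h4 using 2; ring
  rw [e2, e3, e4, n2, n3, n4]
  field_simp
  ring

/-- Two-particle Caduceus identity in regime 2(a), boundary (1,0,1,0). -/
theorem stmt5 :
    b1 X1 X2⁻¹ * b2 X1⁻¹ X2
      + c2 X1 X2 * c1 X1 X2⁻¹ * c1 X1⁻¹ X2 * c2 X1⁻¹ X2⁻¹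
      - X1 ^ 2 * (c2 X1 X2 * c1 X1⁻¹ X2 * b1 X1⁻¹ X2⁻¹)
      - X2 ^ 2 * (b1 X1 X2 * c1 X1⁻¹ X2 * c2 X1⁻¹ X2⁻¹)
      + X1 ^ 2 * X2 ^ 2 * (b1 X1 X2 * c2 X1 X2⁻¹ * c1 X1⁻¹ X2 * b1 X1⁻¹ X2⁻¹) = 1 := by
  have hx : X1 ≠ 0 := algebraMap_ne_zero_of_eval _ (by simp)
  have hy : X2 ≠ 0 := algebraMap_ne_zero_of_eval _ (by simp)
  have h1 : X1 - qq * X2 ≠ 0 := by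
    have := algebraMap_ne_zero_of_eval
      (MvPolynomial.X 1 - MvPolynomial.X 0 * MvPolynomial.X 2) (by simp; norm_num)
    simpa only [X1, X2, qq, map_sub, map_mul] using this
  have h2 : X1 * X2 - qq ≠ 0 := by
    have := algebraMap_ne_zero_of_eval
      (MvPolynomial.X 1 * MvPolynomial.X 2 - MvPolynomial.X 0) (by simp; norm_num)
    simpa only [X1, X2, qq, map_sub, map_mul] using this
  have h3 : 1 - qq * X1 * X2 ≠ 0 := by
    have := algebraMap_ne_zero_of_eval
      (1 - MvPolynomial.X 0 * MvPolynomial.X 1 * MvPolynomial.X 2) (by simp; norm_num)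
    simpa only [X1, X2, qq, map_sub, map_mul, map_one] using this
  have h4 : X2 - qq * X1 ≠ 0 := by
    have := algebraMap_ne_zero_of_eval
      (MvPolynomial.X 2 - MvPolynomial.X 0 * MvPolynomial.X 1) (by simp; norm_num)
    simpa only [X1, X2, qq, map_sub, map_mul] using this
  exact caduceus_field qq X1 X2 hx hy h1 h2 h3 h4
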